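/- If (E_1, …, E_n) is a complete exceptional sequence in rep Q, then the product of the associated reflections satisfies s_{E_1} s_{E_2} ⋯ s_{E_n} = cox(Q). -/

import Mathlib

open CategoryTheory CategoryTheory.Limits ZeroObject

attribute [local instance] CategoryTheory.Abelian.hasFiniteBiproducts

noncomputable section

namespace NCPaper

/-- A finite quiver without oriented cycles. -/
structure FinQuiver : Type 1 where
  V : Type
  [quiver : Quiver.{0} V]
  [fintypeV : Fintype V]
  [fintypeArr : ∀ a b : V, Fintype (a ⟶ b)]
  acyclic : ∀ (v : V) (p : Quiver.Path v v), p = Quiver.Path.nil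

attribute [instance] FinQuiver.quiver FinQuiver.fintypeV FinQuiver.fintypeArr

variable (k : Type) [Field k] (Q : FinQuiver)

/-- The ambient abelian category of all `k`-linear representations of `Q`;
finite-dimensional representations are singled out by the predicate `FinDim`. -/
abbrev RepC : Type 1 := Paths Q.V ⥤ ModuleCat.{0} k

variable {k Q}

/-- `M` is a finite-dimensional representation, i.e. an object of `rep Q`. -/
def FinDim (M : RepC k Q) : Prop :=
  ∀ v : Q.V, FiniteDimensional k (M.obj ((Paths.of Q.V).obj v))

section Cat

variable {C : Type*} [Category C] [Abelian C]

/-- `X` is a direct summand of `A`. -/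
def IsSummand (X A : C) : Prop := ∃ (i : X ⟶ A) (r : A ⟶ X), i ≫ r = 𝟙 X

/-- The additive closure of a set of objects: direct summands of finite direct sums. -/
def addSet (S : Set C) : Set C :=
  { X | ∃ (n : ℕ) (f : Fin n → C), (∀ i, f i ∈ S) ∧ IsSummand X (⨁ f) }

/-- `Gen S`: all quotients of objects of the additive closure of `S`. -/
def gen (S : Set C) : Set C := { X | ∃ A ∈ addSet S, ∃ p : A ⟶ X, Epi p }

/-- All morphisms from `A` to `B` vanish. -/
def HomZero (A B : C) : Prop := ∀ f : A ⟶ B, f = 0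

/-- `Ext¹(A, B) = 0`, expressed by the splitting of all short exact sequences
`0 ⟶ B ⟶ E ⟶ A ⟶ 0`. -/
def Ext1Zero (A B : C) : Prop :=
  ∀ (E : C) (i : B ⟶ E) (p : E ⟶ A) (w : i ≫ p = 0),
    (ShortComplex.mk i p w).ShortExact → ∃ r : E ⟶ B, i ≫ r = 𝟙 B

/-- An indecomposable object. -/
def Indec (X : C) : Prop :=
  ¬ IsZero X ∧ ∀ (A B : C), (X ≅ A ⊞ B) → IsZero A ∨ IsZero B

/-- A torsion class: a full subcategory (identified with its set of objects) closed under
direct sums, direct summands, quotients and extensions. -/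
structure IsTorsionClass (T : Set C) : Prop where
  zero_mem : (0 : C) ∈ T
  sum_mem : ∀ X ∈ T, ∀ Y ∈ T, (X ⊞ Y : C) ∈ T
  summand_mem : ∀ X ∈ T, ∀ Y : C, IsSummand Y X → Y ∈ T
  quot_mem : ∀ X ∈ T, ∀ (Y : C) (p : X ⟶ Y), Epi p → Y ∈ T
  ext_mem : ∀ S : ShortComplex C, S.ShortExact → S.X₁ ∈ T → S.X₃ ∈ T → S.X₂ ∈ T

/-- A wide subcategory: a full subcategory (closed under direct sums and summands)
which is exact abelian (closed under kernels and cokernels) and closed under extensions. -/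
structure IsWide (A : Set C) : Prop where
  zero_mem : (0 : C) ∈ A
  sum_mem : ∀ X ∈ A, ∀ Y ∈ A, (X ⊞ Y : C) ∈ A
  summand_mem : ∀ X ∈ A, ∀ Y : C, IsSummand Y X → Y ∈ A
  ker_mem : ∀ X ∈ A, ∀ Y ∈ A, ∀ f : X ⟶ Y, (kernel f : C) ∈ A
  coker_mem : ∀ X ∈ A, ∀ Y ∈ A, ∀ f : X ⟶ Y, (cokernel f : C) ∈ A
  ext_mem : ∀ S : ShortComplex C, S.ShortExact → S.X₁ ∈ A → S.X₃ ∈ A → S.X₂ ∈ A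

/-- `P` is split projective in the subcategory `T`: every epimorphism onto `P`
from an object of `T` splits. -/
def SplitProjIn (T : Set C) (P : C) : Prop :=
  P ∈ T ∧ ∀ X ∈ T, ∀ p : X ⟶ P, Epi p → ∃ s : P ⟶ X, s ≫ p = 𝟙 P

/-- `P` is Ext-projective in the subcategory `T`. -/
def ExtProjIn (T : Set C) (P : C) : Prop := P ∈ T ∧ ∀ X ∈ T, Ext1Zero P X

/-- The subcategory `a(T)` associated to a torsion class `T`. -/
def aSet (T : Set C) : Set C :=
  { B | B ∈ T ∧ ∀ Y ∈ T, ∀ g : Y ⟶ B, (kernel g : C) ∈ T }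

/-- A subcategory is finitely generated if it is generated by a single object of it. -/
def IsFinGen (T : Set C) : Prop := ∃ U ∈ T, T ⊆ gen {U}

/-- `U` is a generator of the subcategory `T`. -/
def IsGenerator (T : Set C) (U : C) : Prop := U ∈ T ∧ T ⊆ gen {U}

/-- `X` is a subquotient of `M`. -/
def IsSubquotient (X M : C) : Prop := ∃ (N : C) (i : N ⟶ M) (p : N ⟶ X), Mono i ∧ Epi p

/-- The support of `M` is contained in the support of `C0`: every simple subquotient
(composition factor) of `M` is a composition factor of `C0`. -/
def SuppLE (M C0 : C) : Prop := ∀ S : C, Simple S → IsSubquotient S M → IsSubquotient S C0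

/-- A partial tilting object of a hereditary category. -/
def IsPartialTilting (T : C) : Prop := Ext1Zero T T

/-- `T` is a tilting object of the full subcategory `A`: it is self-orthogonal and every
(split) projective object of `A` admits a coresolution `0 ⟶ P ⟶ T' ⟶ T'' ⟶ 0` with
`T', T'' ∈ add T`. For `A` the subcategory of representations supported on `supp T`,
this says exactly that `T` is a tilting `kQ/ann T`-module. -/
def TiltingIn (A : Set C) (T : C) : Prop :=
  T ∈ A ∧ Ext1Zero T T ∧
    ∀ P : C, SplitProjIn A P →
      ∃ (T' T'' : C) (_ : T' ∈ addSet {T}) (_ : T'' ∈ addSet {T})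
        (i : P ⟶ T') (p : T' ⟶ T'') (w : i ≫ p = 0),
        (ShortComplex.mk i p w).ShortExact


/-- `U` is the direct sum of one representative of each isomorphism class of
indecomposable Ext-projective objects of `T`. -/
def IsExtProjSum (T : Set C) (U : C) : Prop :=
  ∃ (n : ℕ) (f : Fin n → C),
    (∀ i, Indec (f i) ∧ ExtProjIn T (f i)) ∧
    (∀ i j, Nonempty (f i ≅ f j) → i = j) ∧
    (∀ P : C, Indec P → ExtProjIn T P → ∃ i, Nonempty (P ≅ f i)) ∧
    Nonempty (U ≅ ⨁ f)

/-- A basic object: a direct sum of pairwise non-isomorphic indecomposables. -/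
def IsBasic (U : C) : Prop :=
  ∃ (n : ℕ) (f : Fin n → C), (∀ i, Indec (f i)) ∧
    (∀ i j, Nonempty (f i ≅ f j) → i = j) ∧ Nonempty (U ≅ ⨁ f)

end Cat

/-- A support tilting object of `rep Q`: partial tilting, and tilting as a
`kQ/ann T`-module, i.e. tilting in the subcategory of all finite-dimensional
representations supported on the support of `T`. -/
def IsSupportTilting {k : Type} [Field k] {Q : FinQuiver} (T : RepC k Q) : Prop :=
  IsPartialTilting T ∧ TiltingIn { M : RepC k Q | FinDim M ∧ SuppLE M T } T

section Comb

/-- The dimension vector of a representation. -/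
def dimVec {k : Type} [Field k] {Q : FinQuiver} (M : RepC k Q) : Q.V → ℤ :=
  fun v => (Module.finrank k (M.obj ((Paths.of Q.V).obj v)) : ℤ)

/-- The Euler form of the quiver `Q`. -/
def euler (Q : FinQuiver) {R : Type} [CommRing R] (α β : Q.V → R) : R :=
  (∑ v : Q.V, α v * β v) - ∑ a : (Σ x : Q.V, Σ y : Q.V, x ⟶ y), α a.1 * β a.2.1

/-- The symmetrized Euler form of the quiver `Q`. -/
def symEuler (Q : FinQuiver) {R : Type} [CommRing R] (α β : Q.V → R) : R :=
  euler Q α β + euler Q β α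

/-- The reflection in the vector `v`: `s_v(w) = w - (v, w)·v`. -/
def reflV (Q : FinQuiver) (v : Q.V → ℤ) : (Q.V → ℤ) → (Q.V → ℤ) :=
  fun w => w - symEuler Q v w • v

/-- The composition (product, written from left to right) of a finite sequence of
linear transformations. -/
def comps (Q : FinQuiver) {m : ℕ} (g : Fin m → ((Q.V → ℤ) → (Q.V → ℤ))) :
    (Q.V → ℤ) → (Q.V → ℤ) :=
  (List.ofFn g).foldr (· ∘ ·) id

open scoped Classical in
/-- The simple root at a vertex. -/
def simRoot (Q : FinQuiver) (v : Q.V) : Q.V → ℤ := fun w => if w = v then 1 else 0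

/-- The simple reflection at a vertex. -/
def sref (Q : FinQuiver) (v : Q.V) : (Q.V → ℤ) → (Q.V → ℤ) := reflV Q (simRoot Q v)

/-- An enumeration of the vertices is compatible with the arrows of `Q` if sources
of arrows come before targets. -/
def OrdCompatible (Q : FinQuiver) (ord : Fin (Fintype.card Q.V) ≃ Q.V) : Prop :=
  ∀ (x y : Q.V), (x ⟶ y) → ord.symm x < ord.symm y

/-- The Coxeter element `cox(Q)`: the product of the simple reflections from left to
right in an order compatible with the arrows of `Q`. -/
def coxeter (Q : FinQuiver) (ord : Fin (Fintype.card Q.V) ≃ Q.V) :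
    (Q.V → ℤ) → (Q.V → ℤ) :=
  comps Q fun i => sref Q (ord i)

/-- The product of the simple reflections indexed by a word (a list of vertices). -/
def wordProd (Q : FinQuiver) (l : List Q.V) : (Q.V → ℤ) → (Q.V → ℤ) :=
  (l.map (sref Q)).foldr (· ∘ ·) id

/-- Membership in the Coxeter group `W` (realized faithfully on the root lattice). -/
def InW (Q : FinQuiver) (w : (Q.V → ℤ) → (Q.V → ℤ)) : Prop :=
  ∃ l : List Q.V, w = wordProd Q l

/-- The reflections of `W`: the conjugates of the simple reflections. -/
def IsRefl (Q : FinQuiver) (t : (Q.V → ℤ) → (Q.V → ℤ)) : Prop :=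
  ∃ (l : List Q.V) (i : Q.V), t = wordProd Q l ∘ sref Q i ∘ wordProd Q l.reverse

/-- The absolute length: the least length of an expression as a product of reflections. -/
def ellT (Q : FinQuiver) (w : (Q.V → ℤ) → (Q.V → ℤ)) : ℕ :=
  sInf { m | ∃ f : Fin m → ((Q.V → ℤ) → (Q.V → ℤ)), (∀ i, IsRefl Q (f i)) ∧ w = comps Q f }

/-- The absolute order on `W`. -/
def absLe (Q : FinQuiver) : ((Q.V → ℤ) → (Q.V → ℤ)) → ((Q.V → ℤ) → (Q.V → ℤ)) → Prop :=
  Relation.ReflTransGen fun u v => ∃ t, IsRefl Q t ∧ v = u ∘ t ∧ ellT Q v = ellT Q u + 1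

/-- The noncrossing partitions `NC_Q`: the interval `[e, cox(Q)]` in absolute order. -/
def NCSet (Q : FinQuiver) (ord : Fin (Fintype.card Q.V) ≃ Q.V) :
    Set ((Q.V → ℤ) → (Q.V → ℤ)) :=
  { w | InW Q w ∧ absLe Q w (coxeter Q ord) }

/-- `Q` is of finite (Dynkin) type: the symmetrized Euler form is positive definite. -/
def FiniteType (Q : FinQuiver) : Prop :=
  ∀ α : Q.V → ℚ, α ≠ 0 → 0 < symEuler Q α α

/-- `Q` is of affine (extended Dynkin) type: the symmetrized Euler form is positive
semidefinite with nontrivial radical. -/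
def AffineType (Q : FinQuiver) : Prop :=
  (∀ α : Q.V → ℚ, 0 ≤ symEuler Q α α) ∧ ∃ α : Q.V → ℚ, α ≠ 0 ∧ symEuler Q α α = 0

end Comb


section Aux

variable {k : Type} [Field k] {Q : FinQuiver}

/-- space at a vertex -/
abbrev sp (M : RepC k Q) (v : Q.V) : ModuleCat.{0} k := M.obj ((Paths.of Q.V).obj v)

/-- map of an arrow -/
def mp (M : RepC k Q) {x y : Q.V} (a : x ⟶ y) : sp M x →ₗ[k] sp M y :=
  (M.map ((Paths.of Q.V).map a)).hom

/-- morphism from family -/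
def mkHom (M N : RepC k Q) (φ : ∀ v, sp M v →ₗ[k] sp N v)
    (h : ∀ (x y : Q.V) (a : x ⟶ y), mp N a ∘ₗ φ x = φ y ∘ₗ mp M a) : M ⟶ N where
  app v := ModuleCat.ofHom (φ v)
  naturality := by
    intro X Y f
    let ψ : ∀ v : Paths Q.V, M.obj v ⟶ N.obj v := fun v => ModuleCat.ofHom (φ v)
    change M.map f ≫ ψ Y = ψ X ≫ N.map f
    refine Paths.induction (V := Q.V) (P := fun {a b} f => M.map f ≫ ψ b = ψ a ≫ N.map f) ?_ ?_ f
    · intro v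
      rw [M.map_id, N.map_id, Category.id_comp, Category.comp_id]
    · intro u v w p q hp
      have hq : M.map ((Paths.of Q.V).map q) ≫ ψ ((Paths.of Q.V).obj w) =
          ψ ((Paths.of Q.V).obj v) ≫ N.map ((Paths.of Q.V).map q) := by
        ext1
        exact (h v w q).symm
      rw [M.map_comp, N.map_comp, Category.assoc, hq, ← Category.assoc, hp, Category.assoc]

lemma mkHom_app (M N : RepC k Q) (φ) (h) (v : Q.V) :
    ((mkHom M N φ h).app ((Paths.of Q.V).obj v)).hom = φ v := rfl

lemma hom_comm {M N : RepC k Q} (f : M ⟶ N) {x y : Q.V} (a : x ⟶ y) :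
    mp N a ∘ₗ (f.app ((Paths.of Q.V).obj x)).hom = (f.app ((Paths.of Q.V).obj y)).hom ∘ₗ mp M a := by
  have := f.naturality ((Paths.of Q.V).map a)
  exact (congrArg ModuleCat.Hom.hom this).symm

/-- arrows -/
abbrev Arr (Q : FinQuiver) := Σ x : Q.V, Σ y : Q.V, x ⟶ y

/-- the standard differential -/
def dd (M N : RepC k Q) : (∀ v, sp M v →ₗ[k] sp N v) →ₗ[k] (∀ a : Arr Q, sp M a.1 →ₗ[k] sp N a.2.1) where
  toFun φ := fun a => mp N a.2.2 ∘ₗ φ a.1 - φ a.2.1 ∘ₗ mp M a.2.2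
  map_add' φ ψ := by
    funext a
    simp only [Pi.add_apply, LinearMap.comp_add, LinearMap.add_comp]
    abel
  map_smul' c φ := by
    funext a
    simp [LinearMap.comp_smul, LinearMap.smul_comp, smul_sub]

lemma dd_apply (M N : RepC k Q) (φ) (a : Arr Q) :
  dd M N φ a = mp N a.2.2 ∘ₗ φ a.1 - φ a.2.1 ∘ₗ mp M a.2.2 := rfl

/-- extension -/
def extObj (M N : RepC k Q) (ψ : ∀ a : Arr Q, sp M a.1 →ₗ[k] sp N a.2.1) : RepC k Q :=
  Paths.lift { obj := fun v => ModuleCat.of k (sp N v × sp M v)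
               map := fun {x y} a => ModuleCat.ofHom
                (LinearMap.prod (mp N a ∘ₗ LinearMap.fst k _ _ + ψ ⟨x, y, a⟩ ∘ₗ LinearMap.snd k _ _)
                  (mp M a ∘ₗ LinearMap.snd k _ _)) }

lemma mp_extObj (M N : RepC k Q) (ψ) {x y : Q.V} (a : x ⟶ y) :
    mp (extObj M N ψ) a = (LinearMap.prod (mp N a ∘ₗ LinearMap.fst k _ _ + ψ ⟨x, y, a⟩ ∘ₗ LinearMap.snd k _ _)
                  (mp M a ∘ₗ LinearMap.snd k (sp N x) (sp M x))) := by
  unfold mp extObj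
  erw [Paths.lift_toPath]
  rfl

lemma exact_of_app (S : ShortComplex (RepC k Q))
    (h : ∀ v, (S.map ((evaluation _ _).obj v)).Exact) : S.Exact := by
  rw [ShortComplex.exact_iff_isZero_homology]
  refine Functor.isZero _ fun v => ?_
  have := (ShortComplex.exact_iff_isZero_homology _).1 (h v)
  exact this.of_iso (S.mapHomologyIso ((evaluation _ _).obj v)).symm

lemma aux_inl {N N' M M' : Type} [AddCommGroup N] [AddCommGroup N'] [AddCommGroup M]
    [AddCommGroup M'] [Module k N] [Module k N'] [Module k M] [Module k M']
    (n : N →ₗ[k] N') (m : M →ₗ[k] M') (p : M →ₗ[k] N') :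
    (LinearMap.prod (n ∘ₗ LinearMap.fst k _ _ + p ∘ₗ LinearMap.snd k _ _)
      (m ∘ₗ LinearMap.snd k N M)) ∘ₗ LinearMap.inl k N M = LinearMap.inl k N' M' ∘ₗ n := by
  ext z <;> simp

lemma aux_snd {N N' M M' : Type} [AddCommGroup N] [AddCommGroup N'] [AddCommGroup M]
    [AddCommGroup M'] [Module k N] [Module k N'] [Module k M] [Module k M']
    (n : N →ₗ[k] N') (m : M →ₗ[k] M') (p : M →ₗ[k] N') :
    m ∘ₗ LinearMap.snd k N M = LinearMap.snd k N' M' ∘ₗ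
    (LinearMap.prod (n ∘ₗ LinearMap.fst k _ _ + p ∘ₗ LinearMap.snd k _ _)
      (m ∘ₗ LinearMap.snd k N M)) := by
  ext z <;> simp

lemma aux_fin {N N' M M' : Type} [AddCommGroup N] [AddCommGroup N'] [AddCommGroup M]
    [AddCommGroup M'] [Module k N] [Module k N'] [Module k M] [Module k M']
    (n : N →ₗ[k] N') (m : M →ₗ[k] M') (p : M →ₗ[k] N') (r : N × M →ₗ[k] N)
    (r' : N' × M' →ₗ[k] N')
    (h : n ∘ₗ r = r' ∘ₗ
    (LinearMap.prod (n ∘ₗ LinearMap.fst k _ _ + p ∘ₗ LinearMap.snd k _ _)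
      (m ∘ₗ LinearMap.snd k N M))) (h' : ∀ z, r' (z, 0) = z) (z : M) :
    (n ∘ₗ (r ∘ₗ LinearMap.inr k N M) - (r' ∘ₗ LinearMap.inr k N' M') ∘ₗ m) z = p z := by
  have h2 := LinearMap.congr_fun h (0, z)
  have h3 : ((p z, m z) : N' × M') = (p z, 0) + (0, m z) := by simp
  simp only [LinearMap.comp_apply, LinearMap.prod_apply, Function.prod, LinearMap.add_apply,
    LinearMap.fst_apply, LinearMap.snd_apply, map_zero, zero_add] at h2
  rw [h3, map_add, h'] at h2
  simp [h2]

lemma dd_surj (M N : RepC k Q) (h : Ext1Zero M N) : Function.Surjective (dd M N) := by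
  intro ψ
  let i : N ⟶ extObj M N ψ := mkHom N (extObj M N ψ) (fun v => LinearMap.inl k (sp N v) (sp M v)) (by
    intro x y a
    rw [mp_extObj]
    exact aux_inl (mp N a) (mp M a) (ψ ⟨x, y, a⟩))
  let p : extObj M N ψ ⟶ M := mkHom (extObj M N ψ) M (fun v => LinearMap.snd k (sp N v) (sp M v)) (by
    intro x y a
    rw [mp_extObj]
    exact aux_snd (mp N a) (mp M a) (ψ ⟨x, y, a⟩))
  have w : i ≫ p = 0 := by
    ext v x
    rfl
  obtain ⟨r, hr⟩ := h (extObj M N ψ) i p w (by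
    have : Mono (ShortComplex.mk i p w).f := by
      refine @NatTrans.mono_of_mono_app _ _ _ _ _ _ _ fun v => ?_
      rw [ModuleCat.mono_iff_injective]
      exact LinearMap.inl_injective (M := sp N v) (M₂ := sp M v) (R := k)
    have : Epi (ShortComplex.mk i p w).g := by
      refine @NatTrans.epi_of_epi_app _ _ _ _ _ _ _ fun v => ?_
      rw [ModuleCat.epi_iff_surjective]
      exact LinearMap.snd_surjective (M := sp N v) (M₂ := sp M v) (R := k)
    refine ⟨exact_of_app _ fun v => ?_⟩
    rw [ShortComplex.moduleCat_exact_iff]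
    intro x hx
    obtain ⟨x1, x2⟩ : sp N v × sp M v := x
    have hx : x2 = 0 := hx
    subst hx
    exact ⟨x1, rfl⟩)
  refine ⟨fun v => (r.app ((Paths.of Q.V).obj v)).hom ∘ₗ LinearMap.inr k (sp N v) (sp M v), ?_⟩
  have hri : ∀ (v : Q.V) (z : sp N v), (r.app ((Paths.of Q.V).obj v)).hom ((z, (0 : sp M v)) : sp N v × sp M v) = z := by
    intro v z
    have := congrArg (fun t : N ⟶ N => (NatTrans.app t ((Paths.of Q.V).obj v)).hom z) hr
    exact this
  funext a
  obtain ⟨x, y, a⟩ := a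
  ext z
  have hc := hom_comm r a
  rw [mp_extObj] at hc
  exact aux_fin (mp N a) (mp M a) (ψ ⟨x, y, a⟩) _ _ hc (hri y) z

lemma ker_dd (M N : RepC k Q) (h : HomZero M N) (φ) (hφ : dd M N φ = 0) : φ = 0 := by
  have := h (mkHom M N φ (fun x y a => sub_eq_zero.1 (congrFun hφ ⟨x, y, a⟩)))
  funext v
  rw [← mkHom_app M N φ (fun x y a => sub_eq_zero.1 (congrFun hφ ⟨x, y, a⟩)) v, this]
  rfl

lemma finrank_dd (M N : RepC k Q) (hM : FinDim M) (hN : FinDim N) (h : Ext1Zero M N) :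
    (Module.finrank k (LinearMap.ker (dd M N)) : ℤ) = euler Q (dimVec M) (dimVec N) := by
  have : ∀ v, FiniteDimensional k (sp M v) := hM
  have : ∀ v, FiniteDimensional k (sp N v) := hN
  have h1 := LinearMap.finrank_range_add_finrank_ker (dd M N)
  rw [LinearMap.range_eq_top.2 (dd_surj M N h), finrank_top, Module.finrank_pi_fintype, Module.finrank_pi_fintype] at h1
  simp only [Module.finrank_linearMap] at h1
  unfold euler dimVec
  zify at h1
  rw [← h1]
  abel

end Aux

section Brick

variable {k : Type} [Field k] {Q : FinQuiver}

lemma dd_eq_zero_iff (M N : RepC k Q) (φ) :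
    dd M N φ = 0 ↔ ∀ (x y : Q.V) (a : x ⟶ y), mp N a ∘ₗ φ x = φ y ∘ₗ mp M a :=
  ⟨fun h x y a => sub_eq_zero.1 (congrFun h ⟨x, y, a⟩),
    fun h => funext fun a => sub_eq_zero.2 (h a.1 a.2.1 a.2.2)⟩

lemma idem_triv_cat {C : Type*} [Category C] [Abelian C] {X : C} (hX : Indec X) (e : X ⟶ X)
    (he : e ≫ e = e) : e = 0 ∨ e = 𝟙 X := by
  have he' := Idempotents.idem_of_id_sub_idem e he
  obtain ⟨A, i, r, h1, h2⟩ := IsIdempotentComplete.idempotents_split X e he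
  obtain ⟨B, j, s, h3, h4⟩ := IsIdempotentComplete.idempotents_split X _ he'
  have his : i ≫ s = 0 := by
    have a1 : i ≫ e = i := by rw [← h2, ← Category.assoc, h1, Category.id_comp]
    have a2 : (𝟙 X - e) ≫ s = s := by rw [← h4, Category.assoc, h3, Category.comp_id]
    rw [← a1, ← a2]
    simp [reassoc_of% he]
  have hjr : j ≫ r = 0 := by
    have a1 : j ≫ (𝟙 X - e) = j := by rw [← h4, ← Category.assoc, h3, Category.id_comp]
    have a2 : e ≫ r = r := by rw [← h2, Category.assoc, h1, Category.comp_id]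
    rw [← a1, ← a2]
    simp [reassoc_of% he]
  have iso : X ≅ A ⊞ B :=
    { hom := biprod.lift r s
      inv := biprod.desc i j
      hom_inv_id := by simp [h2, h4]
      inv_hom_id := by
        ext <;> simp [h1, h3, his, hjr] }
  rcases hX.2 A B iso with h | h
  · left
    rw [← h2, h.eq_of_tgt r 0, zero_comp]
  · right
    have : 𝟙 X - e = 0 := by rw [← h4, h.eq_of_tgt s 0, zero_comp]
    exact (sub_eq_zero.1 this).symm

abbrev PP (M : RepC k Q) := ∀ v, Module.End k (sp M v)

/-- Endomorphism algebra -/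
def EA (M : RepC k Q) : Subalgebra k (PP M) where
  carrier := {φ | dd M M φ = 0}
  mul_mem' := by
    intro φ ψ hφ hψ
    simp only [Set.mem_ofPred_eq, dd_eq_zero_iff] at *
    intro x y a
    simp only [Pi.mul_apply, Module.End.mul_eq_comp]
    rw [← LinearMap.comp_assoc, hφ, LinearMap.comp_assoc, hψ, LinearMap.comp_assoc]
  add_mem' := by
    intro φ ψ hφ hψ
    simp only [Set.mem_ofPred_eq] at *
    exact (map_add (dd M M) φ ψ).trans (by rw [hφ, hψ, add_zero])
  algebraMap_mem' := by
    intro c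
    simp only [Set.mem_ofPred_eq, dd_eq_zero_iff]
    intro x y a
    ext z
    simp [Algebra.algebraMap_eq_smul_one]

lemma mem_EA (M : RepC k Q) (φ : PP M) :
    φ ∈ EA M ↔ ∀ (x y : Q.V) (a : x ⟶ y), mp M a ∘ₗ φ x = φ y ∘ₗ mp M a := dd_eq_zero_iff M M φ

lemma idem_triv {M : RepC k Q} (hM : Indec M) {e : PP M} (he : e ∈ EA M) (h2 : e * e = e) :
    e = 0 ∨ e = 1 := by
  have hh := (mem_EA M e).1 he
  have := idem_triv_cat hM (mkHom M M e hh) (by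
    ext v : 2
    exact ModuleCat.hom_ext (congrFun h2 v))
  rcases this with h | h
  · left
    funext v
    rw [← mkHom_app M M e hh v, h]
    rfl
  · right
    funext v
    rw [← mkHom_app M M e hh v, h]
    rfl

open Polynomial in
lemma fitting {M : RepC k Q} (hfd : FinDim M) (hM : Indec M) {f : PP M} (hf : f ∈ EA M) :
    IsUnit f ∨ IsNilpotent f := by
  have : ∀ v, FiniteDimensional k (sp M v) := hfd
  have hint : IsIntegral k f := Algebra.IsIntegral.isIntegral f
  have hp0 := minpoly.ne_zero hint
  obtain ⟨q, hq, hnd⟩ := Polynomial.exists_eq_pow_rootMultiplicity_mul_and_not_dvd (minpoly k f) hp0 0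
  set n := rootMultiplicity 0 (minpoly k f)
  rw [map_zero, sub_zero] at hq hnd
  have hcop : IsCoprime (X ^ (n+1)) q :=
    IsCoprime.pow_left ((Polynomial.irreducible_X.coprime_iff_not_dvd).2 hnd)
  obtain ⟨a, b, hab⟩ := hcop
  have hz : aeval f (X ^ (n+1) * q) = 0 := by
    rw [show (X ^ (n+1) * q : k[X]) = X * (X ^ n * q) by ring, ← hq, map_mul, minpoly.aeval, mul_zero]
  have hmem : aeval f (a * X ^ (n+1)) ∈ EA M := by
    have := (aeval (⟨f, hf⟩ : EA M) (a * X ^ (n+1))).2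
    have h2 := Polynomial.aeval_algHom_apply (EA M).val (⟨f, hf⟩ : EA M) (a * X ^ (n+1))
    exact h2 ▸ this
  have hid : aeval f (a * X ^ (n+1)) * aeval f (a * X ^ (n+1)) = aeval f (a * X ^ (n+1)) := by
    rw [← map_mul, ← sub_eq_zero, ← map_sub]
    have : a * X ^ (n+1) * (a * X ^ (n+1)) - a * X ^ (n+1) = - (a * b) * (X ^ (n+1) * q) := by
      linear_combination (a * X ^ (n+1)) * hab
    rw [this, map_mul, hz, mul_zero]
  rcases idem_triv hM hmem hid with h | h
  · right
    refine ⟨n+1, ?_⟩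
    have h1 : (X ^ (n+1) : k[X]) = X ^ (n+1) * (a * X ^ (n+1)) + b * (X ^ (n+1) * q) := by
      linear_combination - (X ^ (n+1)) * hab
    have h2 := congrArg (aeval f) h1
    rw [map_add, map_mul, h, map_mul _ b, hz, mul_zero, mul_zero, add_zero] at h2
    simpa using h2
  · left
    have h1 : aeval f (a * X ^ n) * f = 1 := by
      rw [← h, show a * X ^ (n+1) = (a * X ^ n) * X by ring, map_mul _ _ X, aeval_X]
    have h2 : f * aeval f (a * X ^ n) = 1 := by
      rw [← h, show a * X ^ (n+1) = X * (a * X ^ n) by ring, map_mul _ X, aeval_X]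
    exact ⟨⟨f, _, h2, h1⟩, rfl⟩

lemma ginv {V : Type} [AddCommGroup V] [Module k V] (f : Module.End k V) :
    ∃ s : Module.End k V, f * s * f = f := by
  obtain ⟨g, hg⟩ := f.rangeRestrict.exists_rightInverse_of_surjective f.range_rangeRestrict
  obtain ⟨s, hs⟩ := g.exists_extend
  refine ⟨s, ?_⟩
  ext z
  have h1 := LinearMap.congr_fun hs (f.rangeRestrict z)
  have h2 := congrArg Subtype.val (LinearMap.congr_fun hg (f.rangeRestrict z))
  simp only [LinearMap.comp_apply, Submodule.subtype_apply, LinearMap.codRestrict_apply, LinearMap.id_apply] at h1 h2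
  simp only [Module.End.mul_apply]
  refine (congrArg f h1).trans h2

lemma unit_of_mul {M : RepC k Q} (hfd : FinDim M) {f g : PP M} (h : IsUnit (f * g)) :
    IsUnit f ∧ IsUnit g := by
  have : ∀ v, FiniteDimensional k (sp M v) := hfd
  rw [Pi.isUnit_iff] at h
  simp only [Pi.isUnit_iff, ← forall_and]
  intro v
  have hv := h v
  rw [Pi.mul_apply, Module.End.isUnit_iff] at hv
  constructor
  · rw [LinearMap.isUnit_iff_range_eq_top, LinearMap.range_eq_top]
    exact Function.Surjective.of_comp hv.2
  · rw [LinearMap.isUnit_iff_ker_eq_bot, LinearMap.ker_eq_bot]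
    exact Function.Injective.of_comp hv.1

lemma happel_ringel {M : RepC k Q} (hfd : FinDim M) (hM : Indec M) (hE : Ext1Zero M M)
    {f : PP M} (hf : f ∈ EA M) (hu : ¬ IsUnit f) : f = 0 := by
  choose s hs using fun v => ginv (f v)
  have hf' := (mem_EA M f).1 hf
  obtain ⟨φ, hφ⟩ := dd_surj M M hE
    (fun a => (mp M a.2.2 ∘ₗ s a.1 - s a.2.1 ∘ₗ mp M a.2.2) ∘ₗ (1 - f a.1 * s a.1))
  have hφ' : ∀ (x y : Q.V) (a : x ⟶ y), mp M a ∘ₗ φ x - φ y ∘ₗ mp M a =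
      (mp M a ∘ₗ s x - s y ∘ₗ mp M a) ∘ₗ (1 - f x * s x) := fun x y a => congrFun hφ ⟨x, y, a⟩
  have F : ∀ (x y : Q.V) (a : x ⟶ y) (z), mp M a (f x z) = f y (mp M a z) :=
    fun x y a z => LinearMap.congr_fun (hf' x y a) z
  have S : ∀ v z, f v (s v (f v z)) = f v z := fun v z => LinearMap.congr_fun (hs v) z
  have H : ∀ (x y : Q.V) (a : x ⟶ y) (z), mp M a (φ x z) - φ y (mp M a z) =
      mp M a (s x (z - f x (s x z))) - s y (mp M a (z - f x (s x z))) :=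
    fun x y a z => LinearMap.congr_fun (hφ' x y a) z
  have hg : (φ * f : PP M) ∈ EA M := by
    rw [mem_EA]
    intro x y a
    ext z
    have := H x y a (f x z)
    rw [S, sub_self, map_zero, map_zero, map_zero, sub_self, F] at this
    exact sub_eq_zero.1 this
  have he : (f * (s - φ) : PP M) ∈ EA M := by
    rw [mem_EA]
    intro x y a
    ext z
    have h1 := congrArg (f y) (H x y a z)
    simp only [map_sub] at h1
    change mp M a (f x (s x z - φ x z)) = f y (s y (mp M a z) - φ y (mp M a z))
    have h2 : f y (mp M a (s x (f x (s x z)))) = f y (mp M a (s x z)) := by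
      rw [← F, ← F, S]
    have h3 : f y (s y (mp M a (f x (s x z)))) = f y (mp M a (s x z)) := by
      rw [F, S]
    rw [h2, h3] at h1
    rw [map_sub, map_sub, map_sub, F, F]
    rw [sub_self, zero_sub] at h1
    have h4 : f y (mp M a (φ x z)) = f y (φ y (mp M a z)) + -(f y (s y (mp M a z)) - f y (mp M a (s x z))) := by
      rw [← h1]; abel
    rw [h4]; abel
  have hgn := (fitting hfd hM hg).resolve_left fun h => hu (unit_of_mul hfd h).2
  have hen := (fitting hfd hM he).resolve_left fun h => hu (unit_of_mul hfd h).1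
  have hs' : f * s * f = f := funext hs
  have key : (f * (s - φ)) * f = f * (1 - φ * f) := by
    rw [mul_sub, sub_mul, hs', mul_sub, mul_one, mul_assoc]
  obtain ⟨u, hu'⟩ := hgn.isUnit_one_sub
  have key2 : f = (f * (s - φ)) * f * (↑u⁻¹ : PP M) := by
    rw [key, ← hu', mul_assoc, Units.mul_inv, mul_one]
  have iter : ∀ n : ℕ, f = (f * (s - φ)) ^ n * f * (↑u⁻¹ : PP M) ^ n := by
    intro n
    induction n with
    | zero => simp
    | succ n ih =>
      calc f = (f * (s - φ)) ^ n * f * (↑u⁻¹ : PP M) ^ n := ih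
        _ = (f * (s - φ)) ^ n * ((f * (s - φ)) * f * (↑u⁻¹ : PP M)) * (↑u⁻¹ : PP M) ^ n := by rw [← key2]
        _ = _ := by rw [pow_succ, pow_succ']; simp only [mul_assoc]
  obtain ⟨n, hn⟩ := hen
  rw [iter n, hn, zero_mul, zero_mul]

lemma euler_self [IsAlgClosed k] {M : RepC k Q} (hfd : FinDim M) (hM : Indec M) (hE : Ext1Zero M M) :
    euler Q (dimVec M) (dimVec M) = 1 := by
  have : ∀ v, FiniteDimensional k (sp M v) := hfd
  rw [← finrank_dd M M hfd hfd hE]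
  have hnz : ∃ v, Nontrivial (sp M v) := by
    by_contra hcon
    push Not at hcon
    apply hM.1
    refine Functor.isZero _ fun v => ?_
    have := hcon v
    exact @ModuleCat.isZero_of_subsingleton k _ (sp M v) this
  obtain ⟨v, hv⟩ := hnz
  norm_cast
  rw [finrank_eq_one_iff']
  refine ⟨⟨(1 : PP M), (EA M).one_mem⟩, ?_, ?_⟩
  · intro h
    have h1 : (1 : PP M) = 0 := congrArg Subtype.val h
    have h2 : (1 : Module.End k (sp M v)) = 0 := congrFun h1 v
    exact one_ne_zero h2
  · rintro ⟨f, hf⟩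
    obtain ⟨c, hc⟩ := Module.End.exists_eigenvalue (f v)
    refine ⟨c, Subtype.ext ?_⟩
    have hf' : (f : PP M) ∈ EA M := hf
    have hmem : (f - c • 1 : PP M) ∈ EA M := (EA M).sub_mem hf' ((EA M).smul_mem (EA M).one_mem c)
    have := happel_ringel hfd hM hE hmem (by
      intro h
      rw [Pi.isUnit_iff] at h
      have h1 := (Module.End.isUnit_iff _).1 (h v)
      obtain ⟨z, hz⟩ := hc.exists_hasEigenvector
      apply hz.2
      apply h1.1
      rw [map_zero]
      change f v z - c • z = 0
      rw [hz.apply_eq_smul, sub_self])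
    exact (sub_eq_zero.1 this).symm

lemma euler_zero {M N : RepC k Q} (hM : FinDim M) (hN : FinDim N) (h : HomZero M N)
    (hE : Ext1Zero M N) : euler Q (dimVec M) (dimVec N) = 0 := by
  rw [← finrank_dd M N hM hN hE, (LinearMap.ker_eq_bot'.2 (ker_dd M N h)), finrank_bot]
  rfl

end Brick

section CombAux

variable {Q : FinQuiver}

lemma euler_sub_right (a b c : Q.V → ℤ) : euler Q a (b - c) = euler Q a b - euler Q a c := by
  simp only [euler, Pi.sub_apply, mul_sub, Finset.sum_sub_distrib]; ring

lemma euler_sub_left (a b c : Q.V → ℤ) : euler Q (a - b) c = euler Q a c - euler Q b c := by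
  simp only [euler, Pi.sub_apply, sub_mul, Finset.sum_sub_distrib]; ring

lemma euler_smul_right (t : ℤ) (a b : Q.V → ℤ) : euler Q a (t • b) = t * euler Q a b := by
  simp only [euler, Pi.smul_apply, smul_eq_mul, mul_sub, Finset.mul_sum]
  congr 1 <;> exact Finset.sum_congr rfl fun _ _ => by ring

lemma euler_smul_left (t : ℤ) (a b : Q.V → ℤ) : euler Q (t • a) b = t * euler Q a b := by
  simp only [euler, Pi.smul_apply, smul_eq_mul, mul_sub, Finset.mul_sum]
  congr 1 <;> exact Finset.sum_congr rfl fun _ _ => by ring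

lemma euler_sum_right {ι : Type} (s : Finset ι) (a : Q.V → ℤ) (b : ι → Q.V → ℤ) :
    euler Q a (∑ i ∈ s, b i) = ∑ i ∈ s, euler Q a (b i) := by
  let f : (Q.V → ℤ) →+ ℤ := AddMonoidHom.ofMapSub (fun b => euler Q a b) (euler_sub_right a)
  exact map_sum f b s

/-- product of reflections -/
def lp (Q : FinQuiver) (l : List (Q.V → ℤ)) : (Q.V → ℤ) → (Q.V → ℤ) :=
  (l.map (reflV Q)).foldr (· ∘ ·) id

lemma comps_eq {m : ℕ} (x : Fin m → Q.V → ℤ) :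
    comps Q (fun i => reflV Q (x i)) = lp Q (List.ofFn x) := by
  unfold comps lp
  rw [List.map_ofFn]
  rfl

lemma lp_cons (a : Q.V → ℤ) (l) (v) :
    lp Q (a :: l) v = lp Q l v - symEuler Q a (lp Q l v) • a := rfl

lemma lp_orth (a : Q.V → ℤ) (l : List (Q.V → ℤ)) (h : ∀ b ∈ l, euler Q b a = 0) (v) :
    euler Q (lp Q l v) a = euler Q v a := by
  induction l with
  | nil => rfl
  | cons b l ih =>
    rw [lp_cons, euler_sub_left, euler_smul_left, h b (by simp), mul_zero, sub_zero]
    exact ih fun c hc => h c (by simp [hc])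

lemma lp_main (l : List (Q.V → ℤ)) (h : l.Pairwise fun a b => euler Q b a = 0)
    (h1 : ∀ a ∈ l, euler Q a a = 1) (v) : ∀ x ∈ l, euler Q x (lp Q l v) = - euler Q v x := by
  induction l with
  | nil => simp
  | cons a l ih =>
    rw [List.pairwise_cons] at h
    intro x hx
    rw [lp_cons, euler_sub_right, euler_smul_right]
    rcases List.mem_cons.1 hx with rfl | hx
    · rw [h1 x (by simp), symEuler, ← lp_orth x l h.1 v]
      ring
    · rw [h.1 x hx, mul_zero, sub_zero]
      exact ih h.2 (fun b hb => h1 b (by simp [hb])) x hx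

lemma lp_fn {m : ℕ} (x : Fin m → Q.V → ℤ) (h1 : ∀ i, euler Q (x i) (x i) = 1)
    (h : ∀ i j, i < j → euler Q (x j) (x i) = 0) (v) (i) :
    euler Q (x i) (lp Q (List.ofFn x) v) = - euler Q v (x i) := by
  apply lp_main
  · rw [List.pairwise_ofFn]
    exact fun i j => h i j
  · intro a ha
    obtain ⟨i, rfl⟩ := (List.mem_ofFn' _ _).1 ha
    exact h1 i
  · exact (List.mem_ofFn' _ _).2 ⟨i, rfl⟩

lemma sum_simRoot (ord : Fin (Fintype.card Q.V) ≃ Q.V) (w : Q.V → ℤ) :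
    w = ∑ j, w (ord j) • simRoot Q (ord j) := by
  classical
  funext v
  rw [Finset.sum_apply, Equiv.sum_comp ord (fun u => (w u • simRoot Q u) v)]
  simp [simRoot]

lemma euler_expand (ord : Fin (Fintype.card Q.V) ≃ Q.V) (a w : Q.V → ℤ) :
    euler Q a w = ∑ j, euler Q a (simRoot Q (ord j)) * w (ord j) := by
  conv_lhs => rw [sum_simRoot ord w]
  rw [euler_sum_right]
  exact Finset.sum_congr rfl fun j _ => by rw [euler_smul_right, mul_comm]

lemma nondeg (ord : Fin (Fintype.card Q.V) ≃ Q.V) (x : Fin (Fintype.card Q.V) → Q.V → ℤ)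
    (h1 : ∀ i, euler Q (x i) (x i) = 1)
    (h : ∀ i j, i < j → euler Q (x j) (x i) = 0) :
    let Y : Matrix _ _ ℤ := Matrix.of fun i j => euler Q (x i) (simRoot Q (ord j))
    let X : Matrix _ _ ℤ := Matrix.of fun i j => x i (ord j)
    Y.det ≠ 0 ∧ X.det ≠ 0 := by
  intro Y X
  have hT : Y * X.transpose = Matrix.of fun i j => euler Q (x i) (x j) := by
    ext i j
    rw [Matrix.mul_apply, Matrix.of_apply, euler_expand ord]
    rfl
  have hd : (Y * X.transpose).det = 1 := by
    rw [hT, Matrix.det_of_upperTriangular]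
    · simp [h1]
    · intro i j hij
      exact h j i hij
  rw [Matrix.det_mul, Matrix.det_transpose] at hd
  constructor <;> intro h0 <;> simp [h0] at hd

lemma nondeg_right (ord : Fin (Fintype.card Q.V) ≃ Q.V) (x : Fin (Fintype.card Q.V) → Q.V → ℤ)
    (h1 : ∀ i, euler Q (x i) (x i) = 1)
    (h : ∀ i j, i < j → euler Q (x j) (x i) = 0) (d : Q.V → ℤ)
    (hd : ∀ i, euler Q (x i) d = 0) : d = 0 := by
  have hY := (nondeg ord x h1 h).1
  have := Matrix.eq_zero_of_mulVec_eq_zero hY (v := d ∘ ord) (by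
    funext i
    exact (euler_expand ord (x i) d).symm.trans (hd i))
  funext v
  simpa using congrFun this (ord.symm v)

lemma euler_simRoot_self (ord : Fin (Fintype.card Q.V) ≃ Q.V) (hord : OrdCompatible Q ord) (v : Q.V) :
    euler Q (simRoot Q v) (simRoot Q v) = 1 := by
  classical
  unfold euler
  rw [Finset.sum_eq_zero (s := (Finset.univ : Finset (Σ x : Q.V, Σ y : Q.V, x ⟶ y)))]
  · simp [simRoot]
  · rintro ⟨x, y, a⟩ -
    have := hord x y a
    simp only [simRoot]
    split_ifs with h1 h2 <;> simp_all

lemma euler_simRoot_zero (ord : Fin (Fintype.card Q.V) ≃ Q.V) (hord : OrdCompatible Q ord) (i j)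
    (hij : i < j) : euler Q (simRoot Q (ord j)) (simRoot Q (ord i)) = 0 := by
  classical
  unfold euler
  rw [Finset.sum_eq_zero (s := (Finset.univ : Finset (Σ x : Q.V, Σ y : Q.V, x ⟶ y))), sub_zero,
    Finset.sum_eq_zero]
  · intro v _
    simp only [simRoot]
    split_ifs with h1 h2
    · rw [h1] at h2
      exact absurd (ord.injective h2) hij.ne'
    all_goals simp
  · rintro ⟨x, y, a⟩ -
    have := hord x y a
    simp only [simRoot]
    split_ifs with h1 h2
    · subst h1 h2
      simp at this
      exact absurd this (not_lt.2 hij.le)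
    all_goals simp

lemma lp_simple (ord : Fin (Fintype.card Q.V) ≃ Q.V) (hord : OrdCompatible Q ord) (v u : Q.V → ℤ) :
    euler Q u (lp Q (List.ofFn fun i => simRoot Q (ord i)) v) = - euler Q v u := by
  have h := lp_fn (fun i => simRoot Q (ord i)) (fun i => euler_simRoot_self ord hord _)
    (fun i j hij => euler_simRoot_zero ord hord i j hij) v
  set w := lp Q (List.ofFn fun i => simRoot Q (ord i)) v
  have hl : euler Q u w = ∑ j, u (ord j) * euler Q (simRoot Q (ord j)) w := by
    let f : (Q.V → ℤ) →+ ℤ := AddMonoidHom.ofMapSub (fun b => euler Q b w) fun a b => euler_sub_left a b w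
    conv_lhs => rw [sum_simRoot ord u]
    refine (map_sum f _ _).trans ?_
    exact Finset.sum_congr rfl fun j _ => euler_smul_left _ _ _
  rw [hl, euler_expand ord v u, ← Finset.sum_neg_distrib]
  refine Finset.sum_congr rfl fun j _ => ?_
  rw [h j]
  ring

end CombAux

section Statement14

/-- If `(E₁, …, E_n)` is a complete exceptional sequence in `rep Q`
then the product of the associated reflections satisfies
`s_{E₁} s_{E₂} ⋯ s_{E_n} = cox(Q)`. -/
theorem statement14 (k : Type) [Field k] [IsAlgClosed k] (Q : FinQuiver)
    (ord : Fin (Fintype.card Q.V) ≃ Q.V) (hord : OrdCompatible Q ord)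
    (E : Fin (Fintype.card Q.V) → RepC k Q)
    (hfd : ∀ i, FinDim (E i)) (hindec : ∀ i, Indec (E i))
    (hexc : ∀ i, Ext1Zero (E i) (E i))
    (hseq : ∀ i j, i < j → HomZero (E j) (E i) ∧ Ext1Zero (E j) (E i)) :
    comps Q (fun i => reflV Q (dimVec (E i))) = coxeter Q ord := by
  have h1 : ∀ i, euler Q (dimVec (E i)) (dimVec (E i)) = 1 :=
    fun i => euler_self (hfd i) (hindec i) (hexc i)
  have h0 : ∀ i j, i < j → euler Q (dimVec (E j)) (dimVec (E i)) = 0 :=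
    fun i j hij => euler_zero (hfd j) (hfd i) (hseq i j hij).1 (hseq i j hij).2
  have hc : coxeter Q ord = lp Q (List.ofFn fun i => simRoot Q (ord i)) :=
    comps_eq (fun i => simRoot Q (ord i))
  rw [comps_eq (fun i => dimVec (E i)), hc]
  funext v
  refine sub_eq_zero.1 (nondeg_right ord (fun i => dimVec (E i)) h1 h0 _ fun i => ?_)
  rw [euler_sub_right, lp_simple ord hord]
  have := lp_fn (fun i => dimVec (E i)) h1 h0 v i
  rw [this, sub_self]

end Statement14
end NCPaper
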